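/- Fix reals m < M and k > 0, let H : [m,M] → ℝ be continuous, and let f : [m,M] → ℝ be bounded. Define (M f)(r) = sup_{0 ≤ ζ ≤ M−r} ( f(r+ζ) − H(r+ζ) + H(r) − k ). Assume f(r) ≥ (M f)(r) for every r ∈ [m,M]. If r₀ ∈ [m,M] satisfies f(r₀) = (M f)(r₀), then for every r′ ∈ [m,M] with r′ ≤ r₀ one has f(r′) − H(r′) ≥ f(r₀) − H(r₀). -/

import Mathlib

open Set

/-- Intervention operator
`(M f)(r) = sup_{0 ≤ ζ ≤ M - r} ( f(r+ζ) - H(r+ζ) + H(r) - k )`. -/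
noncomputable def Mop (M k : ℝ) (H f : ℝ → ℝ) (r : ℝ) : ℝ :=
  sSup ((fun ζ : ℝ => f (r + ζ) - H (r + ζ) + H r - k) '' Icc 0 (M - r))

/-- The set whose supremum defines `Mop M k H f r` is bounded above when `f` is bounded and `H` is
continuous on the state space. -/
theorem bddAbove_intervention_values {m M k : ℝ} {H f : ℝ → ℝ}
    (hH : ContinuousOn H (Icc m M)) (hf : ∃ C : ℝ, ∀ z ∈ Icc m M, |f z| ≤ C)
    {r : ℝ} (hr : m ≤ r) :
    BddAbove ((fun ζ : ℝ => f (r + ζ) - H (r + ζ) + H r - k) '' Icc 0 (M - r)) := by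
  obtain ⟨C, hC⟩ := hf
  obtain ⟨B, hB⟩ := isCompact_Icc.bddBelow_image hH
  refine ⟨C - B + H r - k, ?_⟩
  rintro _ ⟨ζ, hζ, rfl⟩
  have hmem : r + ζ ∈ Icc m M := ⟨by linarith [hζ.1], by linarith [hζ.2]⟩
  have hfle := (abs_le.mp (hC _ hmem)).2
  have hHge := hB (mem_image_of_mem H hmem)
  simp only
  linarith

/-- `r ↦ Mop M k H f r - H r` is antitone on the state space. -/
theorem Mop_sub_antitoneOn {m M k : ℝ} {H f : ℝ → ℝ}
    (hH : ContinuousOn H (Icc m M)) (hf : ∃ C : ℝ, ∀ z ∈ Icc m M, |f z| ≤ C) :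
    AntitoneOn (fun r => Mop M k H f r - H r) (Icc m M) := by
  intro r hr s hs hrs
  have hle : Mop M k H f s ≤ Mop M k H f r - H r + H s := by
    refine csSup_le ((nonempty_Icc.mpr (sub_nonneg.mpr hs.2)).image _) ?_
    rintro _ ⟨ζ, hζ, rfl⟩
    have hval := le_csSup (bddAbove_intervention_values (k := k) hH hf hr.1)
      (mem_image_of_mem _ (show s - r + ζ ∈ Icc 0 (M - r) from
        ⟨by linarith [hζ.1], by linarith [hζ.2]⟩))
    simp only [show r + (s - r + ζ) = s + ζ by ring] at hval
    simp only [Mop]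
    linarith
  simp only
  linarith

/-- Step in the proof of optimality of the `(s̲, s̄, S)` policy (Theorem 5.1):
if `f ≥ M f` everywhere and `f(r₀) = (M f)(r₀)`, then `f - H` at any point to
the left of `r₀` dominates its value at `r₀`. -/
theorem left_of_intervention_set
    (m M k : ℝ) (hmM : m < M) (hk : 0 < k)
    (H : ℝ → ℝ) (hH : ContinuousOn H (Icc m M))
    (f : ℝ → ℝ) (hf_bdd : ∃ C : ℝ, ∀ z ∈ Icc m M, |f z| ≤ C)
    (hf : ∀ r ∈ Icc m M, Mop M k H f r ≤ f r)
    (r₀ : ℝ) (hr₀ : r₀ ∈ Icc m M) (hr₀I : f r₀ = Mop M k H f r₀) :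
    ∀ r' ∈ Icc m M, r' ≤ r₀ → f r₀ - H r₀ ≤ f r' - H r' := by
  intro r' hr' hle
  have hanti := Mop_sub_antitoneOn (k := k) hH hf_bdd hr' hr₀ hle
  simp only at hanti
  linarith [hf r' hr']
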